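/- Let F₄ : ℝ⁴ → ℝ⁴ be F₄(t,x,y,v) = (−x·v + y², 0, −t·y, t·v). There is no differentiable curve γ : ℝ → ℝ⁴, defined on all of ℝ, with γ(0) = (2, 1, 0, −2) and γ'(s) = F₄(γ(s)) for every s ∈ ℝ. (Hence the left-invariant Lorentzian metric on Sol × ℝ determined by q₄ is geodesically incomplete; taking a compact quotient by a cocompact lattice yields an incomplete compact Lorentzian manifold with a null Killing field.) -/

import Mathlib

/-- The Euler–Arnold field `F₄(t,x,y,v) = (−x·v + y², 0, −t·y, t·v)`. -/
def F4 : ℝ × ℝ × ℝ × ℝ → ℝ × ℝ × ℝ × ℝ :=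
  fun p => (-(p.2.1 * p.2.2.2) + p.2.2.1 ^ 2, 0, -(p.1 * p.2.2.1), p.1 * p.2.2.2)

/-- No function on the whole line starts at `2` and has derivative at least half its square. -/
theorem false_of_half_sq_le_deriv {f f' : ℝ → ℝ} (hf : ∀ s, HasDerivAt f (f' s) s)
    (hle : ∀ s, f s ^ 2 / 2 ≤ f' s) (h0 : f 0 = 2) : False := by
  have hmono : Monotone f := monotone_of_hasDerivAt_nonneg hf fun s =>
    (by positivity : (0 : ℝ) ≤ f s ^ 2 / 2).trans (hle s)
  have hpos : ∀ s, 0 ≤ s → 0 < f s := fun s hs => by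
    linarith [hmono hs]
  have hg : ∀ s, 0 ≤ s →
      HasDerivAt (fun s => (f s)⁻¹ + s / 2) (-f' s / f s ^ 2 + 1 / 2) s := fun s hs =>
    ((hf s).fun_inv (hpos s hs).ne').add ((hasDerivAt_id s).div_const 2)
  have hanti : AntitoneOn (fun s => (f s)⁻¹ + s / 2) (Set.Icc 0 1) := by
    refine antitoneOn_of_hasDerivWithinAt_nonpos (convex_Icc 0 1)
      (fun s hs => (hg s hs.1).continuousAt.continuousWithinAt)
      (fun s hs => (hg s (interior_subset hs).1).hasDerivWithinAt) fun s hs => ?_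
    have hfs : 0 < f s ^ 2 := pow_pos (hpos s (interior_subset hs).1) 2
    have hdiv : 1 / 2 ≤ f' s / f s ^ 2 := by
      rw [le_div_iff₀ hfs]
      linarith [hle s]
    rw [neg_div]
    linarith
  have h1 := hanti (Set.left_mem_Icc.2 zero_le_one) (Set.right_mem_Icc.2 zero_le_one)
    zero_le_one
  norm_num [h0] at h1
  exact (hpos 1 zero_le_one).not_ge h1

/-- There is no globally defined integral curve of `F₄` through `(2, 1, 0, −2)`:
the left invariant Lorentzian metric on `Sol × ℝ` determined by `q₄` is
geodesically incomplete. -/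
theorem no_global_euler_arnold_solution_dim4 :
    ¬ ∃ γ : ℝ → ℝ × ℝ × ℝ × ℝ,
        γ 0 = (2, 1, 0, -2) ∧ ∀ s : ℝ, HasDerivAt γ (F4 (γ s)) s := by
  rintro ⟨γ, h0, hγ⟩
  have ht : ∀ s, HasDerivAt (fun s => (γ s).1) (F4 (γ s)).1 s := fun s =>
    (hasFDerivAt_fst (𝕜 := ℝ)).comp_hasDerivAt (f := fun s => γ s) s (hγ s)
  have hr : ∀ s, HasDerivAt (fun s => (γ s).2) (F4 (γ s)).2 s := fun s =>
    (hasFDerivAt_snd (𝕜 := ℝ)).comp_hasDerivAt (f := fun s => γ s) s (hγ s)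
  have hx : ∀ s, HasDerivAt (fun s => (γ s).2.1) 0 s := fun s =>
    (hasFDerivAt_fst (𝕜 := ℝ)).comp_hasDerivAt (f := fun s => (γ s).2) s (hr s)
  have hyv : ∀ s, HasDerivAt (fun s => (γ s).2.2) (F4 (γ s)).2.2 s := fun s =>
    (hasFDerivAt_snd (𝕜 := ℝ)).comp_hasDerivAt (f := fun s => (γ s).2) s (hr s)
  have hy : ∀ s, HasDerivAt (fun s => (γ s).2.2.1) (F4 (γ s)).2.2.1 s := fun s =>
    (hasFDerivAt_fst (𝕜 := ℝ)).comp_hasDerivAt (f := fun s => (γ s).2.2) s (hyv s)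
  have hv : ∀ s, HasDerivAt (fun s => (γ s).2.2.2) (F4 (γ s)).2.2.2 s := fun s =>
    (hasFDerivAt_snd (𝕜 := ℝ)).comp_hasDerivAt (f := fun s => (γ s).2.2) s (hyv s)
  have hx1 : ∀ s, (γ s).2.1 = 1 := fun s => by
    have h := is_const_of_deriv_eq_zero (fun s => (hx s).differentiableAt)
      (fun s => (hx s).deriv) s 0
    simpa [h0] using h
  have hE : ∀ s, HasDerivAt
      (fun s => (γ s).1 ^ 2 + (γ s).2.2.1 ^ 2 + 2 * (γ s).2.2.2) 0 s := fun s => by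
    refine ((((ht s).fun_pow 2).add ((hy s).fun_pow 2)).add ((hv s).const_mul 2)).congr_deriv ?_
    simp only [F4, hx1]
    push_cast
    ring
  have hE0 : ∀ s, (γ s).1 ^ 2 + (γ s).2.2.1 ^ 2 + 2 * (γ s).2.2.2 = 0 := fun s => by
    have h := is_const_of_deriv_eq_zero (fun s => (hE s).differentiableAt)
      (fun s => (hE s).deriv) s 0
    norm_num [h0] at h
    exact h
  refine false_of_half_sq_le_deriv ht (fun s => ?_) (by simp [h0])
  simp only [F4, hx1]
  linarith [hE0 s, sq_nonneg (γ s).2.2.1]
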